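/- There exists β₀ > 0 such that for every β ≥ β₀ there is a constant c' = c'(β) > 0 with the following property: for every integer r ≥ 1 and every integer h ≥ 1, exp(−β I_r(h) − c' r²) ≤ π_{B_r}(η_0 = h) ≤ exp(−β I_r(h) + c' r²). -/

import Mathlib

open Filter Topology Classical

noncomputable section

abbrev Site : Type := ℤ × ℤ

/-- Nearest-neighbor adjacency in `ℤ²`. -/
def adjP (x y : Site) : Prop := |x.1 - y.1| + |x.2 - y.2| = 1

/-- The Discrete Gaussian Hamiltonian `H(η) = ∑_{x∼y} (η_x - η_y)²`, the sum running over
unordered nearest-neighbor pairs (each ordered pair is counted once, whence the factor 1/2). -/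
def dgH (η : Site → ℤ) : ℝ :=
  (1 / 2) * ∑' p : Site × Site, if adjP p.1 p.2 then ((η p.1 - η p.2 : ℤ) : ℝ) ^ 2 else 0

/-- Unnormalized weight of the event `A` for the DG model on `Λ` with zero boundary conditions. -/
def dgW (β : ℝ) (Λ : Finset Site) (A : (Site → ℤ) → Prop) : ℝ :=
  ∑' η : Site → ℤ, if (∀ x ∉ Λ, η x = 0) ∧ A η then Real.exp (-β * dgH η) else 0

/-- `π_Λ(A)`: probability of the event `A` under the DG measure on `Λ`. -/
def dgProb (β : ℝ) (Λ : Finset Site) (A : (Site → ℤ) → Prop) : ℝ :=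
  dgW β Λ A / dgW β Λ (fun _ => True)

/-- `ϖ_Λ(A)`: DG measure conditioned on the floor event `η ≥ 0`. -/
def dgProbFloor (β : ℝ) (Λ : Finset Site) (A : (Site → ℤ) → Prop) : ℝ :=
  dgW β Λ (fun η => A η ∧ ∀ x, 0 ≤ η x) / dgW β Λ (fun η => ∀ x, 0 ≤ η x)

/-- The box `Λ_L = {1,…,L}²`. -/
def box (L : ℕ) : Finset Site := Finset.Icc (1 : ℤ) (L : ℤ) ×ˢ Finset.Icc (1 : ℤ) (L : ℤ)

/-- The lattice ball `B_r = {x ∈ ℤ² : |x| ≤ r}`. -/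
def ball (r : ℝ) : Finset Site :=
  ((Finset.Icc (-⌈r⌉) ⌈r⌉) ×ˢ (Finset.Icc (-⌈r⌉) ⌈r⌉)).filter
    fun x => ((x.1 : ℝ) ^ 2 + (x.2 : ℝ) ^ 2 ≤ r ^ 2)


/-- The Dirichlet energy `∑_{x∼y} (φ_x - φ_y)²` over unordered nearest-neighbor pairs. -/
def dirichletE (φ : Site → ℝ) : ℝ :=
  (1 / 2) * ∑' p : Site × Site, if adjP p.1 p.2 then (φ p.1 - φ p.2) ^ 2 else 0

/-- `I_r(h)`: infimum of the Dirichlet energy over real-valued `φ` vanishing off `B_r`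
with `φ_0 = h`. -/
def Ir (r : ℝ) (h : ℝ) : ℝ :=
  sInf {E | ∃ φ : Site → ℝ, (∀ x ∉ ball r, φ x = 0) ∧ φ (0, 0) = h ∧ E = dirichletE φ}

def NN (r : ℕ) : Finset Site :=
  Finset.Icc (-((r:ℤ)+2)) ((r:ℤ)+2) ×ˢ Finset.Icc (-((r:ℤ)+2)) ((r:ℤ)+2)

theorem dgball_sub {r : ℕ} {x : Site} (hx : x ∈ ball (r:ℝ)) :
    (-(r:ℤ) ≤ x.1 ∧ x.1 ≤ r) ∧ (-(r:ℤ) ≤ x.2 ∧ x.2 ≤ r) := by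
  simp only [ball, Finset.mem_filter, Finset.mem_product, Finset.mem_Icc, Int.ceil_natCast] at hx
  exact hx.1

theorem zero_mem_ball (r : ℕ) : ((0,0) : Site) ∈ ball (r:ℝ) := by
  simp only [ball, Finset.mem_filter, Finset.mem_product, Finset.mem_Icc, Int.ceil_natCast]
  refine ⟨⟨⟨by simp, by simp⟩, by simp, by simp⟩, ?_⟩
  simp only [Int.cast_zero]
  nlinarith [sq_nonneg (r:ℝ)]

theorem card_ball (r : ℕ) (hr : 1 ≤ r) : ((ball (r:ℝ)).card : ℝ) ≤ 9 * (r:ℝ)^2 := by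
  have h1 : (ball (r:ℝ)).card ≤ (2*r+1)*(2*r+1) := by
    unfold ball
    refine (Finset.card_filter_le _ _).trans ?_
    rw [Finset.card_product, Int.ceil_natCast, Int.card_Icc]
    have : ((r:ℤ) + 1 - -(r:ℤ)).toNat = 2*r+1 := by omega
    rw [this]
  have h2 : ((ball (r:ℝ)).card : ℝ) ≤ (2*r+1)*(2*r+1) := by exact_mod_cast h1
  have h3 : (1:ℝ) ≤ r := by exact_mod_cast hr
  nlinarith

theorem card_NN (r : ℕ) (hr : 1 ≤ r) : ((NN r).card : ℝ) ≤ 49 * (r:ℝ)^2 := by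
  have h1 : (NN r).card = (2*r+5)*(2*r+5) := by
    unfold NN
    rw [Finset.card_product, Int.card_Icc]
    have : ((r:ℤ) + 2 + 1 - -((r:ℤ)+2)).toNat = 2*r+5 := by omega
    rw [this]
  have h2 : ((NN r).card : ℝ) = (2*r+5)*(2*r+5) := by exact_mod_cast h1
  have h3 : (1:ℝ) ≤ r := by exact_mod_cast hr
  nlinarith

theorem adj_bd {x y : Site} (h : adjP x y) :
    (x.1 - 1 ≤ y.1 ∧ y.1 ≤ x.1 + 1) ∧ (x.2 - 1 ≤ y.2 ∧ y.2 ≤ x.2 + 1) := by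
  unfold adjP at h
  have h1 := abs_nonneg (x.1 - y.1)
  have h2 := abs_nonneg (x.2 - y.2)
  have h3 := abs_le.1 (show |x.1 - y.1| ≤ 1 by omega)
  have h4 := abs_le.1 (show |x.2 - y.2| ≤ 1 by omega)
  omega

theorem E_fin {r : ℕ} {φ : Site → ℝ} (hφ : ∀ x ∉ ball (r:ℝ), φ x = 0) :
    dirichletE φ = (1/2) * ∑ p ∈ NN r ×ˢ NN r, if adjP p.1 p.2 then (φ p.1 - φ p.2) ^ 2 else 0 := by
  unfold dirichletE
  rw [tsum_eq_sum]
  rintro ⟨x, y⟩ hp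
  simp only
  split_ifs with h
  · have hb := adj_bd h
    have hx : x ∉ ball (r:ℝ) := by
      intro hx
      apply hp
      have := dgball_sub hx
      simp only [NN, Finset.mem_product, Finset.mem_Icc]
      omega
    have hy : y ∉ ball (r:ℝ) := by
      intro hx
      apply hp
      have := dgball_sub hx
      simp only [NN, Finset.mem_product, Finset.mem_Icc]
      omega
    rw [hφ x hx, hφ y hy]; norm_num
  · rfl

theorem E_par {r : ℕ} {φ ψ : Site → ℝ} (hφ : ∀ x ∉ ball (r:ℝ), φ x = 0)
    (hψ : ∀ x ∉ ball (r:ℝ), ψ x = 0) :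
    dirichletE (fun x => φ x + ψ x) + dirichletE (fun x => φ x - ψ x)
      = 2 * dirichletE φ + 2 * dirichletE ψ := by
  rw [E_fin hφ, E_fin hψ, E_fin (r := r) (φ := fun x => φ x + ψ x),
    E_fin (r := r) (φ := fun x => φ x - ψ x)]
  · simp only [Finset.mul_sum]
    rw [← Finset.sum_add_distrib, ← Finset.sum_add_distrib]
    refine Finset.sum_congr rfl fun p _ => ?_
    split_ifs <;> ring
  · intro x hx; simp [hφ x hx, hψ x hx]
  · intro x hx; simp [hφ x hx, hψ x hx]

theorem E_nonneg (φ : Site → ℝ) : 0 ≤ dirichletE φ := by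
  unfold dirichletE
  refine mul_nonneg (by norm_num) (tsum_nonneg fun p => ?_)
  split_ifs <;> positivity

theorem E_smul (c : ℝ) (φ : Site → ℝ) : dirichletE (fun x => c * φ x) = c^2 * dirichletE φ := by
  unfold dirichletE
  rw [mul_left_comm]
  congr 1
  rw [← tsum_mul_left]
  refine tsum_congr fun p => ?_
  split_ifs <;> ring

theorem E_small {r : ℕ} (hr : 1 ≤ r) {φ : Site → ℝ} (hφ : ∀ x ∉ ball (r:ℝ), φ x = 0)
    (hs : ∀ x, |φ x| ≤ 1/2) : dirichletE φ ≤ 98 * (r:ℝ)^2 := by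
  rw [E_fin hφ, Finset.sum_product]
  have key : ∀ x ∈ NN r, (∑ y ∈ NN r, if adjP x y then (φ x - φ y)^2 else 0) ≤ 4 := by
    intro x _
    calc (∑ y ∈ NN r, if adjP x y then (φ x - φ y)^2 else 0)
        ≤ ∑ y ∈ NN r, if adjP x y then (1:ℝ) else 0 := by
          refine Finset.sum_le_sum fun y _ => ?_
          split_ifs
          · have h1 := abs_le.1 (hs x)
            have h2 := abs_le.1 (hs y)
            nlinarith
          · exact le_rfl
      _ = (((NN r).filter (fun y => adjP x y)).card : ℝ) := by
          rw [Finset.sum_boole]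
      _ ≤ ((({(x.1+1,x.2),(x.1-1,x.2),(x.1,x.2+1),(x.1,x.2-1)} : Finset Site)).card : ℝ) := by
          norm_cast
          refine Finset.card_le_card ?_
          rintro ⟨a, b⟩ hy
          have h := (Finset.mem_filter.1 hy).2
          have hb := adj_bd h
          unfold adjP at h
          simp only at h hb
          simp only [Finset.mem_insert, Finset.mem_singleton, Prod.mk.injEq]
          rcases abs_cases (x.1 - a) with h1 | h1 <;> rcases abs_cases (x.2 - b) with h2 | h2 <;> omega
      _ ≤ 4 := by exact_mod_cast Finset.card_le_four
  have h := Finset.sum_le_sum key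
  rw [Finset.sum_const, nsmul_eq_mul] at h
  have := card_NN r hr
  nlinarith

theorem E_tree {r : ℕ} {φ : Site → ℝ} (hφ : ∀ x ∉ ball (r:ℝ), φ x = 0) :
    (1/2) * ∑ x ∈ ball (r:ℝ), (φ x - φ (x.1+1, x.2))^2 ≤ dirichletE φ := by
  rw [E_fin hφ]
  refine mul_le_mul_of_nonneg_left ?_ (by norm_num)
  have hinj : Set.InjOn (fun x : Site => (x, ((x.1+1, x.2) : Site))) (ball (r:ℝ)) := by
    intro a _ b _ h
    exact (Prod.mk.inj h).1
  have hadj : ∀ x : Site, adjP x (x.1+1, x.2) := by intro x; simp [adjP]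
  have e : ∑ x ∈ ball (r:ℝ), (φ x - φ (x.1+1, x.2))^2 =
      ∑ p ∈ (ball (r:ℝ)).image (fun x : Site => (x, ((x.1+1, x.2) : Site))),
        if adjP p.1 p.2 then (φ p.1 - φ p.2) ^ 2 else 0 := by
    rw [Finset.sum_image hinj]
    refine Finset.sum_congr rfl fun x _ => ?_
    simp [hadj x]
  rw [e]
  refine Finset.sum_le_sum_of_subset_of_nonneg ?_ ?_
  · intro p hp
    obtain ⟨x, hx, rfl⟩ := Finset.mem_image.1 hp
    have := dgball_sub hx
    simp only [NN, Finset.mem_product, Finset.mem_Icc]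
    omega
  · intro p _ _
    split_ifs <;> positivity

theorem gauss_one (γ : ℝ) (hγ : 0 < γ) :
    ∃ κ > (0:ℝ), ∀ (b : ℝ) (F : Finset ℤ), ∑ k ∈ F, Real.exp (-γ * ((k:ℝ) - b)^2) ≤ Real.exp κ := by
  have hs : Summable (fun j : ℤ => Real.exp (-(γ/2) * (j:ℝ)^2)) := by
    have hn : Summable (fun n : ℕ => Real.exp (-(γ/2) * (n:ℝ)^2)) := by
      have h0 : Summable (fun n : ℕ => Real.exp (n * -(γ/2))) :=
        Real.summable_exp_nat_mul_iff.2 (by linarith)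
      refine Summable.of_nonneg_of_le (fun _ => (Real.exp_pos _).le) (fun n => ?_) h0
      apply Real.exp_le_exp.2
      have : (n:ℝ) ≤ (n:ℝ)^2 := by exact_mod_cast Nat.le_self_pow two_ne_zero n
      nlinarith
    refine Summable.of_nat_of_neg (by simpa using hn) (by simpa using hn)
  set S := ∑' j : ℤ, Real.exp (-(γ/2) * (j:ℝ)^2) with hS
  have hSpos : 0 ≤ S := tsum_nonneg fun _ => (Real.exp_pos _).le
  refine ⟨γ + S, by linarith, fun b F => ?_⟩
  have hle : S ≤ Real.exp S := by linarith [Real.add_one_le_exp S]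
  have h1 : ∑ k ∈ F, Real.exp (-γ * ((k:ℝ) - b)^2) ≤
      ∑ k ∈ F, Real.exp γ * Real.exp (-(γ/2) * ((k - ⌊b⌋ : ℤ):ℝ)^2) := by
    refine Finset.sum_le_sum fun k _ => ?_
    rw [← Real.exp_add]
    apply Real.exp_le_exp.2
    push_cast
    have h2 := Int.floor_le b
    have h3 := Int.lt_floor_add_one b
    have : ((k:ℝ) - ⌊b⌋)^2 ≤ 2 * ((k:ℝ) - b)^2 + 2 := by
      nlinarith [sq_nonneg ((k:ℝ) - b - (b - ⌊b⌋))]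
    nlinarith
  rw [← Finset.mul_sum] at h1
  rw [Real.exp_add]
  refine h1.trans (mul_le_mul_of_nonneg_left ?_ (Real.exp_pos _).le)
  refine le_trans ?_ hle
  have hinj : Set.InjOn (fun k : ℤ => k - ⌊b⌋) F := by
    intro a _ c _ h; simpa using h
  rw [← Finset.sum_image (f := fun j : ℤ => Real.exp (-(γ/2) * (j:ℝ)^2)) hinj]
  exact hs.sum_le_tsum _ (fun _ _ => (Real.exp_pos _).le)

theorem prod_bound {ι : Type*} [Fintype ι] [DecidableEq ι] (γ κ : ℝ)
    (hκ : ∀ (b : ℝ) (F : Finset ℤ), ∑ k ∈ F, Real.exp (-γ * ((k:ℝ) - b)^2) ≤ Real.exp κ)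
    (b : ι → ℝ) (F : Finset (ι → ℤ)) :
    ∑ k ∈ F, Real.exp (-γ * ∑ i, ((k i:ℝ) - b i)^2) ≤ Real.exp (κ * Fintype.card ι) := by
  have hsub : F ⊆ Fintype.piFinset (fun i => F.image (fun k => k i)) := by
    intro k hk
    rw [Fintype.mem_piFinset]
    intro i
    exact Finset.mem_image_of_mem _ hk
  refine (Finset.sum_le_sum_of_subset_of_nonneg hsub (fun _ _ _ => (Real.exp_pos _).le)).trans ?_
  have : ∀ k : ι → ℤ, Real.exp (-γ * ∑ i, ((k i:ℝ) - b i)^2)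
      = ∏ i, Real.exp (-γ * ((k i:ℝ) - b i)^2) := by
    intro k
    rw [Finset.mul_sum, Real.exp_sum]
  simp only [this]
  rw [← Finset.prod_univ_sum (fun i => F.image (fun k => k i))
    (fun i (j:ℤ) => Real.exp (-γ * ((j:ℝ) - b i)^2))]
  calc _ ≤ ∏ i : ι, Real.exp κ :=
        Finset.prod_le_prod (fun i _ => Finset.sum_nonneg fun _ _ => (Real.exp_pos _).le)
          (fun i _ => hκ _ _)
    _ = _ := by
        rw [Finset.prod_const, Finset.card_univ, ← Real.exp_nat_mul]; ring_nf

theorem D_inj {r : ℕ} {η ξ : Site → ℤ} (hη : ∀ x ∉ ball (r:ℝ), η x = 0)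
    (hξ : ∀ x ∉ ball (r:ℝ), ξ x = 0)
    (h : ∀ x ∈ ball (r:ℝ), η x - η (x.1+1, x.2) = ξ x - ξ (x.1+1, x.2)) : η = ξ := by
  have key : ∀ n : ℕ, ∀ x : Site, (r:ℤ) + 1 - x.1 ≤ n → η x = ξ x := by
    intro n
    induction n with
    | zero =>
      intro x hx
      have : x ∉ ball (r:ℝ) := fun hm => by have := dgball_sub hm; push_cast at hx; omega
      rw [hη x this, hξ x this]
    | succ n ih =>
      intro x hx
      by_cases hm : x ∈ ball (r:ℝ)
      · have h1 := h x hm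
        have h2 := ih (x.1+1, x.2) (by push_cast at hx ⊢; omega)
        omega
      · rw [hη x hm, hξ x hm]
  funext x
  exact key ((r:ℤ) + 1 - x.1).toNat x (Int.self_le_toNat _)

theorem part_bound (γ : ℝ) (hγ : 0 < γ) :
    ∃ κ > (0:ℝ), ∀ r : ℕ, 1 ≤ r → ∀ φ : Site → ℝ, (∀ x ∉ ball (r:ℝ), φ x = 0) →
      ∀ F : Finset (Site → ℤ), (∀ η ∈ F, ∀ x ∉ ball (r:ℝ), η x = 0) →
      ∑ η ∈ F, Real.exp (-γ * dirichletE (fun x => (η x:ℝ) - φ x)) ≤ Real.exp (κ * (r:ℝ)^2) := by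
  obtain ⟨κ, hκ0, hκ⟩ := gauss_one (γ/2) (by linarith)
  refine ⟨9*κ, by linarith, fun r hr φ hφ F hF => ?_⟩
  let D : (Site → ℤ) → (ball (r:ℝ) → ℤ) := fun η x => η x.1 - η (x.1.1+1, x.1.2)
  let b : ball (r:ℝ) → ℝ := fun x => φ x.1 - φ (x.1.1+1, x.1.2)
  have hinj : Set.InjOn D F := by
    intro η h1 ξ h2 h
    exact D_inj (hF η h1) (hF ξ h2) (fun x hx => congrFun h ⟨x, hx⟩)
  have h1 : ∑ η ∈ F, Real.exp (-γ * dirichletE (fun x => (η x:ℝ) - φ x)) ≤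
      ∑ η ∈ F, Real.exp (-(γ/2) * ∑ i, ((D η i:ℝ) - b i)^2) := by
    refine Finset.sum_le_sum fun η hη => Real.exp_le_exp.2 ?_
    have ht := E_tree (r := r) (φ := fun x => (η x:ℝ) - φ x)
      (fun x hx => by simp [hF η hη x hx, hφ x hx])
    rw [← Finset.sum_coe_sort] at ht
    have e : ∑ i, ((D η i:ℝ) - b i)^2 = ∑ i : ball (r:ℝ),
        ((η i.1:ℝ) - φ i.1 - ((η (i.1.1+1, i.1.2):ℝ) - φ (i.1.1+1, i.1.2)))^2 := by
      refine Finset.sum_congr rfl fun i _ => ?_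
      simp only [D, b]; push_cast; ring
    rw [e]
    nlinarith
  refine h1.trans ?_
  rw [← Finset.sum_image (f := fun k : ball (r:ℝ) → ℤ =>
    Real.exp (-(γ/2) * ∑ i, ((k i:ℝ) - b i)^2)) hinj]
  refine (prod_bound (γ/2) κ hκ b _).trans (Real.exp_le_exp.2 ?_)
  rw [Fintype.card_coe]
  have := card_ball r hr
  nlinarith

theorem dgH_eq (η : Site → ℤ) : dgH η = dirichletE (fun x => (η x:ℝ)) := by
  unfold dgH dirichletE
  push_cast
  rfl

theorem Ir_le {r : ℕ} {h : ℝ} {φ : Site → ℝ} (hφ : ∀ x ∉ ball (r:ℝ), φ x = 0)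
    (h0 : φ (0,0) = h) : Ir r h ≤ dirichletE φ := by
  refine csInf_le ⟨0, ?_⟩ ⟨φ, hφ, h0, rfl⟩
  rintro _ ⟨ψ, _, _, rfl⟩
  exact E_nonneg ψ

theorem Ir_near (r : ℕ) (h : ℝ) : ∃ φ : Site → ℝ, (∀ x ∉ ball (r:ℝ), φ x = 0) ∧ φ (0,0) = h ∧
    dirichletE φ < Ir r h + 1 := by
  have hne : {E | ∃ φ : Site → ℝ, (∀ x ∉ ball (r:ℝ), φ x = 0) ∧ φ (0, 0) = h ∧
      E = dirichletE φ}.Nonempty := by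
    refine ⟨_, fun x => if x = (0,0) then h else 0, ?_, by simp, rfl⟩
    intro x hx
    have : x ≠ (0,0) := fun e => hx (e ▸ zero_mem_ball r)
    simp [this]
  obtain ⟨_, ⟨φ, h1, h2, rfl⟩, h3⟩ := exists_lt_of_csInf_lt hne (lt_add_one _)
  exact ⟨φ, h1, h2, h3⟩

/-- generic upper bound on weights -/
theorem dgW_le {β M : ℝ} {Λ : Finset Site} {A : (Site → ℤ) → Prop}
    (hM : ∀ F : Finset (Site → ℤ), (∀ η ∈ F, (∀ x ∉ Λ, η x = 0) ∧ A η) →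
      ∑ η ∈ F, Real.exp (-β * dgH η) ≤ M) :
    dgW β Λ A ≤ M ∧
      ∀ η, (∀ x ∉ Λ, η x = 0) → A η → Real.exp (-β * dgH η) ≤ dgW β Λ A := by
  have hb : ∀ F : Finset (Site → ℤ),
      ∑ η ∈ F, (if (∀ x ∉ Λ, η x = 0) ∧ A η then Real.exp (-β * dgH η) else 0) ≤ M := by
    intro F
    rw [← Finset.sum_filter]
    exact hM _ (fun η hη => (Finset.mem_filter.1 hη).2)
  have hn : ∀ η : Site → ℤ,
      0 ≤ (if (∀ x ∉ Λ, η x = 0) ∧ A η then Real.exp (-β * dgH η) else 0) := by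
    intro η; split_ifs <;> positivity
  have hs := summable_of_sum_le hn hb
  refine ⟨hs.tsum_le_of_sum_le hb, fun η h1 h2 => ?_⟩
  have := hs.le_tsum η (fun j _ => hn j)
  rwa [if_pos ⟨h1, h2⟩] at this

theorem dg_ball_large_deviation :
    ∃ β₀ > (0 : ℝ), ∀ β ≥ β₀, ∃ c' > (0 : ℝ), ∀ r : ℕ, 1 ≤ r → ∀ h : ℕ, 1 ≤ h →
      Real.exp (-β * Ir r h - c' * (r : ℝ) ^ 2) ≤
          dgProb β (ball r) (fun η => η (0, 0) = (h : ℤ)) ∧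
        dgProb β (ball r) (fun η => η (0, 0) = (h : ℤ)) ≤
          Real.exp (-β * Ir r h + c' * (r : ℝ) ^ 2) := by
  refine ⟨1, one_pos, fun β hβ => ?_⟩
  have hβ0 : 0 < β := by linarith
  obtain ⟨κ₁, hκ₁, H₁⟩ := part_bound β hβ0
  obtain ⟨κ₂, hκ₂, H₂⟩ := part_bound (β/2) (by linarith)
  refine ⟨200 * β + κ₁ + κ₂, by positivity, fun r hr h _ => ?_⟩
  have hr1 : (1:ℝ) ≤ (r:ℝ)^2 := by exact_mod_cast Nat.one_le_pow 2 r hr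
  obtain ⟨φ, hφ, hφ0, hφE⟩ := Ir_near r h
  set I := Ir r h with hI
  -- partition function
  have hZ := dgW_le (β := β) (Λ := ball r) (A := fun _ => True) (M := Real.exp (κ₁ * (r:ℝ)^2)) (by
    intro F hF
    have := H₁ r hr (fun _ => 0) (fun _ _ => rfl) F (fun η hη => (hF η hη).1)
    simpa [dgH_eq] using this)
  -- numerator
  have hW := dgW_le (β := β) (Λ := ball r) (A := fun η => η (0,0) = (h:ℤ))
    (M := Real.exp (-β * (I - 1)) * Real.exp (κ₂ * (r:ℝ)^2)) (by
    intro F hF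
    have h1 := H₂ r hr φ hφ F (fun η hη => (hF η hη).1)
    refine le_trans ?_ (mul_le_mul_of_nonneg_left h1 (Real.exp_pos _).le)
    rw [Finset.mul_sum]
    refine Finset.sum_le_sum fun η hη => ?_
    rw [← Real.exp_add, dgH_eq]
    apply Real.exp_le_exp.2
    obtain ⟨hs, h0⟩ := hF η hη
    have hp := E_par (r := r) (φ := fun x => (η x:ℝ)) (ψ := φ)
      (fun x hx => by simp [hs x hx]) hφ
    have hm := Ir_le (r := r) (h := h) (φ := fun x => (1/2:ℝ) * ((η x:ℝ) + φ x))
      (fun x hx => by simp [hs x hx, hφ x hx]) (by simp only [h0, hφ0]; push_cast; ring)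
    rw [E_smul (1/2) (fun x => (η x:ℝ) + φ x)] at hm
    nlinarith)
  have hZ1 : 1 ≤ dgW β (ball r) (fun _ => True) := by
    have := hZ.2 (fun _ => 0) (fun _ _ => rfl) trivial
    refine le_trans (le_of_eq ?_) this
    rw [dgH_eq]
    simp [dirichletE]
  have hW0 : Real.exp (-β * (I + 2 + 196 * (r:ℝ)^2)) ≤
      dgW β (ball r) (fun η => η (0,0) = (h:ℤ)) := by
    have hs : ∀ x ∉ ball (r:ℝ), round (φ x) = 0 := fun x hx => by simp [hφ x hx]
    refine le_trans (Real.exp_le_exp.2 ?_) (hW.2 (fun x => round (φ x)) hs (by simp [hφ0]))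
    rw [dgH_eq]
    have hδ : ∀ x ∉ ball (r:ℝ), (round (φ x):ℝ) - φ x = 0 := fun x hx => by simp [hφ x hx]
    have h1 := E_small hr hδ (fun x => by rw [abs_sub_comm]; exact abs_sub_round _)
    have hp := E_par hφ hδ
    have hm := Ir_le (r := r) (h := h) (φ := fun x => φ x - ((round (φ x):ℝ) - φ x))
      (fun x hx => by rw [hδ x hx, hφ x hx]; simp) (by simp [hφ0])
    have e : (fun x => φ x + ((round (φ x):ℝ) - φ x)) = fun x => (round (φ x):ℝ) := by
      funext x; ring
    rw [e] at hp
    nlinarith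
  unfold dgProb
  have hZpos : 0 < dgW β (ball r) (fun _ => True) := by linarith
  constructor
  · rw [le_div_iff₀ hZpos]
    refine le_trans (mul_le_mul_of_nonneg_left hZ.1 (Real.exp_pos _).le) (le_trans ?_ hW0)
    rw [← Real.exp_add]
    apply Real.exp_le_exp.2
    nlinarith
  · refine (div_le_self (le_trans (Real.exp_pos _).le hW0) hZ1).trans (hW.1.trans ?_)
    rw [← Real.exp_add]
    apply Real.exp_le_exp.2
    nlinarith
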